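/- Let 1/2 < θ ≤ 2/3. Then ρ_{θ,1}(u) = 1 − (1−θ)u if 1 < u ≤ 1/θ; ρ_{θ,1}(u) = 1 − (1−θ)u + log(1/u + 1 − θ) if 1/θ < u ≤ 2; and ρ_{θ,1}(u) = 1 − (1−θ)u + log(1/u + 1 − θ) + (1−θ)u·log(u/2) if 2 < u < 1/(1−θ). -/

import Mathlib

open MeasureTheory

/-- The region `V_k(u,v)`. -/
def Vk (k : ℕ) (u v : ℝ) : Set (Fin k → ℝ) :=
  {t | (∀ i, t i ∈ Set.Ioo (0:ℝ) 1) ∧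
    (∑ i ∈ Finset.univ.filter (fun i : Fin k => (i : ℕ) < k - 1), t i) < u - 1 ∧
    u - 1 < ∑ i, t i ∧ ∑ i, t i < u - v}

/-- The function `μ_k(u,v)`. -/
noncomputable def muk (k : ℕ) (u v : ℝ) : ℝ :=
  if k = 1 then
    u⁻¹ * (volume (Set.Ioo (0:ℝ) 1 ∩ Set.Ioo (u-1) (u-v))).toReal
  else
    u⁻¹ * ∫ t in Vk k u v,
      ∏ j ∈ Finset.univ.filter (fun j : Fin k => (j : ℕ) < k - 1),
        (u - ∑ i ∈ Finset.univ.filter (fun i : Fin k => i ≤ j), t i)⁻¹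

/-- `μ^{(κ)}(u,v) = ∑_{k ≥ 1} κ^k μ_k(u,v)`. -/
noncomputable def mukappa (κ u v : ℝ) : ℝ := ∑' k : ℕ, κ ^ (k+1) * muk (k+1) u v

/-- `ρ_{θ,κ}(u) = μ^{(κ)}(u, (1-θ)u)`. -/
noncomputable def rhotheta (θ κ u : ℝ) : ℝ := mukappa κ u ((1-θ)*u)

open Set

/-- The integrand of `muk`, extended by zero outside `Vk`. -/
noncomputable def mukIntegrand (k : ℕ) (u v : ℝ) : (Fin k → ℝ) → ℝ :=
  (Vk k u v).indicator fun t =>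
    ∏ j ∈ Finset.univ.filter (fun j : Fin k => (j : ℕ) < k - 1),
      (u - ∑ i ∈ Finset.univ.filter (fun i : Fin k => i ≤ j), t i)⁻¹

/-- The integral in `muk`; it is `u * muk k u v` when `1 < u`. -/
noncomputable def mukIntegral (k : ℕ) (u v : ℝ) : ℝ := ∫ t, mukIntegrand k u v t

lemma measurableSet_Vk (k : ℕ) (u v : ℝ) : MeasurableSet (Vk k u v) := by
  simp only [Vk, measurableSet_setOfPred]
  measurability

lemma one_lt_sub_sum_of_mem_Vk {k : ℕ} {u v : ℝ} {t : Fin k → ℝ} (ht : t ∈ Vk k u v)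
    {j : Fin k} (hj : (j : ℕ) < k - 1) :
    1 < u - ∑ i ∈ Finset.univ.filter (fun i : Fin k => i ≤ j), t i := by
  have hle : ∑ i ∈ Finset.univ.filter (fun i : Fin k => i ≤ j), t i
      ≤ ∑ i ∈ Finset.univ.filter (fun i : Fin k => (i : ℕ) < k - 1), t i := by
    refine Finset.sum_le_sum_of_subset_of_nonneg ?_ fun i _ _ => (ht.1 i).1.le
    intro i hi
    simp only [Finset.mem_filter, Finset.mem_univ, true_and] at hi ⊢
    exact lt_of_le_of_lt hi hj
  linarith [ht.2.1]

lemma integrable_mukIntegrand (k : ℕ) (u v : ℝ) : Integrable (mukIntegrand k u v) := by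
  rw [mukIntegrand, integrable_indicator_iff (measurableSet_Vk k u v)]
  have hsub : Vk k u v ⊆ Set.pi univ fun _ : Fin k => Ioo (0:ℝ) 1 := fun t ht i _ => ht.1 i
  refine Measure.integrableOn_of_bounded (M := 1) ?_ ?_ ?_
  · refine ne_top_of_le_ne_top ?_ (measure_mono hsub)
    rw [Real.volume_pi_Ioo]
    exact ENNReal.prod_ne_top fun i _ => ENNReal.ofReal_ne_top
  · exact (by fun_prop : Measurable fun t : Fin k → ℝ =>
      ∏ j ∈ Finset.univ.filter (fun j : Fin k => (j : ℕ) < k - 1),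
      (u - ∑ i ∈ Finset.univ.filter (fun i : Fin k => i ≤ j), t i)⁻¹).aestronglyMeasurable
  · refine (ae_restrict_iff' (measurableSet_Vk k u v)).2 (Filter.Eventually.of_forall ?_)
    intro t ht
    rw [norm_prod]
    refine Finset.prod_le_one (fun _ _ => norm_nonneg _) fun j hj => ?_
    have h := (one_lt_sub_sum_of_mem_Vk ht (Finset.mem_filter.1 hj).2).le
    rw [norm_inv, Real.norm_of_nonneg (by linarith)]
    exact inv_le_one_of_one_le₀ h

lemma cons_mem_Vk_iff (n : ℕ) (u v s : ℝ) (t : Fin (n + 1) → ℝ) :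
    (Fin.cons s t : Fin (n + 2) → ℝ) ∈ Vk (n + 2) u v ↔
      s ∈ Ioo (0:ℝ) 1 ∧ t ∈ Vk (n + 1) (u - s) v := by
  have h : (∑ i ∈ Finset.univ.filter (fun i : Fin (n + 2) => (i : ℕ) < n + 1),
      (Fin.cons s t : Fin (n + 2) → ℝ) i)
      = s + ∑ i ∈ Finset.univ.filter (fun i : Fin (n + 1) => (i : ℕ) < n), t i := by
    simp [Finset.sum_filter, Fin.sum_univ_succ (n := n + 1)]
  simp only [Vk, mem_ofPred_eq, Nat.add_sub_cancel, show n + 2 - 1 = n + 1 from rfl, h,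
    Fin.forall_fin_succ (n := n + 1), Fin.sum_univ_succ (n := n + 1), Fin.cons_zero, Fin.cons_succ]
  constructor
  · rintro ⟨⟨a, b⟩, c, d, e⟩
    exact ⟨a, b, by linarith, by linarith, by linarith⟩
  · rintro ⟨a, b, c, d, e⟩
    exact ⟨⟨a, b⟩, by linarith, by linarith, by linarith⟩

lemma mukIntegrand_cons (n : ℕ) (u v s : ℝ) (t : Fin (n + 1) → ℝ) :
    mukIntegrand (n + 2) u v (Fin.cons s t) =
      (Ioo (0:ℝ) 1).indicator (fun s => (u - s)⁻¹) s * mukIntegrand (n + 1) (u - s) v t := by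
  have h : (∏ j ∈ Finset.univ.filter (fun j : Fin (n + 2) => (j : ℕ) < n + 1),
      (u - ∑ i ∈ Finset.univ.filter (fun i : Fin (n + 2) => i ≤ j),
        (Fin.cons s t : Fin (n + 2) → ℝ) i)⁻¹)
      = (u - s)⁻¹ * ∏ j ∈ Finset.univ.filter (fun j : Fin (n + 1) => (j : ℕ) < n),
      (u - s - ∑ i ∈ Finset.univ.filter (fun i : Fin (n + 1) => i ≤ j), t i)⁻¹ := by
    simp [Finset.sum_filter, Finset.prod_filter, Fin.sum_univ_succ (n := n + 1),
      Fin.prod_univ_succ (n := n + 1), sub_sub, mul_comm]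
  have hmem := cons_mem_Vk_iff n u v s t
  unfold mukIntegrand
  by_cases hs : s ∈ Ioo (0:ℝ) 1
  · by_cases ht : t ∈ Vk (n + 1) (u - s) v
    · rw [indicator_of_mem (hmem.2 ⟨hs, ht⟩), indicator_of_mem hs, indicator_of_mem ht]
      exact h
    · rw [indicator_of_notMem fun hc => ht (hmem.1 hc).2, indicator_of_notMem ht, mul_zero]
  · rw [indicator_of_notMem fun hc => hs (hmem.1 hc).1, indicator_of_notMem hs, zero_mul]

lemma integrable_mukIntegrand_prod (n : ℕ) (u v : ℝ) :
    Integrable (fun p : ℝ × (Fin (n + 1) → ℝ) =>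
      (Ioo (0:ℝ) 1).indicator (fun s => (u - s)⁻¹) p.1 * mukIntegrand (n + 1) (u - p.1) v p.2) := by
  have e := (volume_preserving_piFinSuccAbove (fun _ : Fin (n + 2) => ℝ) 0).symm
  have h := (e.integrable_comp_emb (MeasurableEquiv.measurableEmbedding _)).2
    (integrable_mukIntegrand (n + 2) u v)
  refine h.congr (Filter.Eventually.of_forall fun p => ?_)
  simp only [← mukIntegrand_cons]
  simp [MeasurableEquiv.piFinSuccAbove, Fin.insertNthEquiv]

lemma integrableOn_mukIntegral (n : ℕ) (u v : ℝ) :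
    IntegrableOn (fun s => (u - s)⁻¹ * mukIntegral (n + 1) (u - s) v) (Ioo 0 1) := by
  rw [← integrable_indicator_iff measurableSet_Ioo]
  refine (integrable_mukIntegrand_prod n u v).integral_prod_left.congr
    (Filter.Eventually.of_forall fun s => ?_)
  simp only [integral_const_mul, indicator_mul_left, mukIntegral]

lemma mukIntegral_succ (n : ℕ) (u v : ℝ) :
    mukIntegral (n + 2) u v = ∫ s in Ioo (0:ℝ) 1, (u - s)⁻¹ * mukIntegral (n + 1) (u - s) v := by
  have e := (volume_preserving_piFinSuccAbove (fun _ : Fin (n + 2) => ℝ) 0).symm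
  rw [mukIntegral, ← e.integral_comp (MeasurableEquiv.measurableEmbedding _),
    ← integral_indicator measurableSet_Ioo]
  calc _ = ∫ p : ℝ × (Fin (n + 1) → ℝ), (Ioo (0:ℝ) 1).indicator (fun s => (u - s)⁻¹) p.1 *
        mukIntegrand (n + 1) (u - p.1) v p.2 := by
        refine integral_congr_ae (Filter.Eventually.of_forall fun p => ?_)
        simp only [← mukIntegrand_cons]
        simp [MeasurableEquiv.piFinSuccAbove, Fin.insertNthEquiv]
    _ = _ := by
        rw [Measure.volume_eq_prod, integral_prod _ (integrable_mukIntegrand_prod n u v)]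
        simp only [integral_const_mul, indicator_mul_left, mukIntegral]

lemma mukIntegral_eq_zero (n : ℕ) {u : ℝ} (v : ℝ) (hu : u ≤ 1) : mukIntegral (n + 1) u v = 0 := by
  have : Vk (n + 1) u v = ∅ := by
    refine eq_empty_of_forall_notMem fun t ht => ?_
    have := Finset.sum_nonneg (s := Finset.univ.filter (fun i : Fin (n + 1) => (i : ℕ) < n + 1 - 1))
      fun i _ => (ht.1 i).1.le
    linarith [ht.2.1]
  simp [mukIntegral, mukIntegrand, this]

lemma mukIntegral_one {u : ℝ} (v : ℝ) (hu : 1 < u) :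
    mukIntegral 1 u v = (volume (Ioo (0:ℝ) 1 ∩ Ioo (u - 1) (u - v))).toReal := by
  have hV : Vk 1 u v = MeasurableEquiv.funUnique (Fin 1) ℝ ⁻¹'
      (Ioo (0:ℝ) 1 ∩ Ioo (u - 1) (u - v)) := by
    ext t
    simp [Vk, hu]
  have hm := (volume_preserving_funUnique (Fin 1) ℝ).measure_preimage
    (measurableSet_Ioo.inter measurableSet_Ioo : MeasurableSet
      (Ioo (0:ℝ) 1 ∩ Ioo (u - 1) (u - v))).nullMeasurableSet
  rw [← hm, ← hV, mukIntegral, mukIntegrand, integral_indicator (measurableSet_Vk 1 u v)]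
  simp [Measure.real]
  congr!

lemma mukIntegral_one_eq_max {u v : ℝ} (hu : 1 < u) :
    mukIntegral 1 u v = max (min 1 (u - v) - (u - 1)) 0 := by
  rw [mukIntegral_one v hu, Ioo_inter_Ioo, Real.volume_Ioo,
    sup_eq_right.2 (by linarith : (0:ℝ) ≤ u - 1), ENNReal.toReal_ofReal']

lemma muk_eq_inv_mul_mukIntegral (n : ℕ) {u : ℝ} (v : ℝ) (hu : 1 < u) :
    muk (n + 1) u v = u⁻¹ * mukIntegral (n + 1) u v := by
  rcases n with _ | n
  · rw [mukIntegral_one v hu]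
    simp [muk]
  · rw [mukIntegral, mukIntegrand, integral_indicator (measurableSet_Vk _ u v)]
    simp [muk]

/-- The value of `∑ k, muk (k + 1) z v` for `1 < z ≤ 2 + v`. -/
noncomputable def muSum (v z : ℝ) : ℝ :=
  1 - v - Real.log (max z (1 + v) / (1 + v)) + v * Real.log (max z 2 / 2)

lemma continuous_log_max_div {c : ℝ} (hc : 0 < c) :
    Continuous fun z : ℝ => Real.log (max z c / c) :=
  Continuous.log (by fun_prop) fun _ => (div_pos (lt_max_of_lt_right hc) hc).ne'

lemma continuous_muSum {v : ℝ} (hv : 0 ≤ v) : Continuous (muSum v) :=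
  (continuous_const.sub (continuous_log_max_div (by linarith))).add
    (continuous_const.mul (continuous_log_max_div two_pos))

lemma integral_log_max_div {a b c : ℝ} (hc : 0 < c) (hac : a ≤ c) :
    ∫ z in a..b, Real.log (max z c / c) =
      max b c * Real.log (max b c / c) - max b c + c := by
  have below : ∀ d, d ≤ c → ∫ z in a..d, Real.log (max z c / c) = 0 := by
    intro d hd
    rw [intervalIntegral.integral_congr (g := fun _ => (0:ℝ)), intervalIntegral.integral_zero]
    intro z hz
    have : z ≤ c := hz.2.trans (max_le hac hd)
    simp [max_eq_right this, hc.ne']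
  rcases le_total b c with h | h
  · rw [below b h, max_eq_right h, div_self hc.ne', Real.log_one]
    ring
  · rw [← intervalIntegral.integral_add_adjacent_intervals (b := c)
      ((continuous_log_max_div hc).intervalIntegrable _ _)
      ((continuous_log_max_div hc).intervalIntegrable _ _), below c le_rfl,
      intervalIntegral.integral_congr (g := fun z => Real.log z - Real.log c)]
    · rw [intervalIntegral.integral_sub (by simp) (by simp), integral_log, max_eq_left h,
        Real.log_div (by linarith) hc.ne']
      simp
      ring
    · intro z hz
      have hz' : c ≤ z := by
        rw [uIcc_of_le h] at hz
        exact hz.1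
      simp only [max_eq_left hz']
      exact Real.log_div (by linarith) hc.ne'

lemma setIntegral_Ioo_indicator_Ioi {f : ℝ → ℝ} {u : ℝ} (hu : 1 < u) :
    ∫ s in Ioo (0:ℝ) 1, (Ioi 1).indicator f (u - s) = ∫ z in max 1 (u - 1)..u, f z := by
  have h : (fun s => (Ioi (1:ℝ)).indicator f (u - s)) =
      (Iio (u - 1)).indicator fun s => f (u - s) := by
    ext s
    simp only [indicator_apply, mem_Ioi, mem_Iio]
    congr 1
    rw [eq_iff_iff]
    constructor <;> intro <;> linarith
  have hmin : (0:ℝ) ≤ min 1 (u - 1) := le_min zero_le_one (by linarith)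
  have hset : Ioo (0:ℝ) 1 ∩ Iio (u - 1) = Ioo 0 (min 1 (u - 1)) := by
    ext s
    simp [and_assoc]
  rw [h, setIntegral_indicator measurableSet_Iio, hset, ← integral_Ioc_eq_integral_Ioo,
    ← intervalIntegral.integral_of_le hmin, intervalIntegral.integral_comp_sub_left,
    sub_zero]
  congr 1
  rcases le_total 1 (u - 1) with h | h
  · rw [min_eq_left h, max_eq_right h]
  · rw [min_eq_right h, max_eq_left h]
    ring

lemma mul_muSum_eq {u v : ℝ} (hv : 0 ≤ v) (hv1 : v < 1) (hu : 1 < u) (huv : u ≤ 2 + v) :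
    u * muSum v u =
      mukIntegral 1 u v + ∫ s in Ioo (0:ℝ) 1, (Ioi 1).indicator (muSum v) (u - s) := by
  have ha : max 1 (u - 1) ≤ 1 + v := max_le (by linarith) (by linarith)
  have i1 : IntervalIntegrable (fun z => Real.log (max z (1 + v) / (1 + v))) volume
    (max 1 (u - 1)) u := (continuous_log_max_div (by linarith)).intervalIntegrable _ _
  have i2 : IntervalIntegrable (fun z => v * Real.log (max z 2 / 2)) volume
    (max 1 (u - 1)) u :=
      (continuous_const.mul (continuous_log_max_div two_pos)).intervalIntegrable _ _
  rw [setIntegral_Ioo_indicator_Ioi hu, mukIntegral_one_eq_max hu]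
  simp only [muSum]
  rw [intervalIntegral.integral_add (by simpa using intervalIntegrable_const.sub i1) i2,
    intervalIntegral.integral_sub intervalIntegrable_const i1,
    intervalIntegral.integral_const_mul, integral_log_max_div (by linarith) ha,
    integral_log_max_div two_pos (ha.trans (by linarith)), intervalIntegral.integral_const,
    smul_eq_mul]
  rcases le_or_gt u (1 + v) with h1 | h1
  · have h2 : u ≤ 2 := by linarith
    rw [max_eq_right h1, max_eq_right h2, max_eq_left (by linarith : u - 1 ≤ 1),
      min_eq_right (by linarith : u - v ≤ 1), max_eq_left (by linarith), div_self (by linarith),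
      div_self two_ne_zero, Real.log_one]
    ring
  · rw [max_eq_left h1.le, min_eq_left (by linarith : 1 ≤ u - v)]
    rcases le_or_gt u 2 with h2 | h2
    · rw [max_eq_right h2, max_eq_left (by linarith : u - 1 ≤ 1),
        max_eq_left (by linarith), div_self two_ne_zero, Real.log_one]
      ring
    · rw [max_eq_left h2.le, max_eq_right (by linarith : 1 ≤ u - 1), max_eq_right (by linarith)]
      ring

lemma integral_inv_le_log_two {u : ℝ} (hu : 1 < u) :
    ∫ z in max 1 (u - 1)..u, z⁻¹ ≤ Real.log 2 := by
  have hm : 0 < max 1 (u - 1) := lt_max_of_lt_left one_pos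
  rw [integral_inv_of_pos hm (by linarith)]
  refine Real.log_le_log (by positivity) ((div_le_iff₀ hm).2 ?_)
  linarith [le_max_left 1 (u - 1), le_max_right 1 (u - 1)]

/-- The difference between `u * muSum v u` and the partial sums of `mukIntegral`. -/
noncomputable def muRemainder (v : ℝ) (N : ℕ) (u : ℝ) : ℝ :=
  u * muSum v u - ∑ k ∈ Finset.range N, mukIntegral (k + 1) u v

lemma indicator_inv_mul_muRemainder (v : ℝ) (N : ℕ) (z : ℝ) :
    (Ioi 1).indicator (fun z => z⁻¹ * muRemainder v N z) z =
      (Ioi 1).indicator (muSum v) z -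
        ∑ k ∈ Finset.range N, z⁻¹ * mukIntegral (k + 1) z v := by
  by_cases hz : 1 < z
  · have : z ≠ 0 := by linarith
    simp only [indicator_of_mem (mem_Ioi.2 hz), muRemainder, mul_sub, ← Finset.mul_sum]
    field_simp
  · have hz' : z ∉ Ioi 1 := hz
    rw [indicator_of_notMem hz', indicator_of_notMem hz', Finset.sum_eq_zero, sub_zero]
    intro k _
    rw [mukIntegral_eq_zero k v (not_lt.1 hz), mul_zero]

lemma muRemainder_succ {u v : ℝ} (hv : 0 ≤ v) (hv1 : v < 1) (hu : 1 < u) (huv : u ≤ 2 + v)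
    (N : ℕ) : muRemainder v (N + 1) u =
      ∫ s in Ioo (0:ℝ) 1, (Ioi 1).indicator (fun z => z⁻¹ * muRemainder v N z) (u - s) := by
  have hint : IntegrableOn (fun s => (Ioi 1).indicator (muSum v) (u - s)) (Ioo 0 1) := by
    have h : IntegrableOn (fun s => muSum v (u - s)) (Ioo 0 1) :=
      (((continuous_muSum hv).comp (by fun_prop)).integrableOn_Icc).mono_set Ioo_subset_Icc_self
    exact h.indicator (t := (fun s => u - s) ⁻¹' Ioi 1)
      (measurableSet_Ioi.preimage (by fun_prop))
  simp only [indicator_inv_mul_muRemainder]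
  rw [integral_sub hint (integrable_finsetSum _ fun k _ => integrableOn_mukIntegral k u v),
    integral_finsetSum _ fun k _ => integrableOn_mukIntegral k u v, muRemainder,
    Finset.sum_range_succ', mul_muSum_eq hv hv1 hu huv]
  simp only [← mukIntegral_succ]
  ring

lemma abs_muRemainder_le {v C : ℝ} (hv : 0 ≤ v) (hv1 : v < 1)
    (hC : ∀ u, 1 < u → u ≤ 2 + v → |u * muSum v u| ≤ C) (N : ℕ) :
    ∀ u, 1 < u → u ≤ 2 + v → |muRemainder v N u| ≤ C * Real.log 2 ^ N := by
  induction N with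
  | zero => simpa [muRemainder] using hC
  | succ N ih =>
    intro u hu huv
    have hC0 : 0 ≤ C := (abs_nonneg _).trans (hC u hu huv)
    have hD : 0 ≤ C * Real.log 2 ^ N := by positivity
    rw [muRemainder_succ hv hv1 hu huv, setIntegral_Ioo_indicator_Ioi hu, ← Real.norm_eq_abs]
    have hle : max 1 (u - 1) ≤ u := max_le hu.le (by linarith)
    calc _ ≤ ∫ z in max 1 (u - 1)..u, C * Real.log 2 ^ N * z⁻¹ := by
          refine intervalIntegral.norm_integral_le_of_norm_le hle
            (Filter.Eventually.of_forall fun z hz => ?_) ?_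
          · have hz1 : 1 < z := lt_of_le_of_lt (le_max_left _ _) hz.1
            rw [norm_mul, norm_inv, Real.norm_of_nonneg (by linarith : 0 ≤ z), mul_comm]
            exact mul_le_mul_of_nonneg_right (ih z hz1 (hz.2.trans huv))
              (inv_nonneg.2 (by linarith))
          · refine (intervalIntegral.intervalIntegrable_inv (fun z hz => ?_)
              continuousOn_id).const_mul _
            rw [uIcc_of_le hle] at hz
            exact (lt_of_lt_of_le one_pos ((le_max_left _ _).trans hz.1)).ne'
      _ ≤ C * Real.log 2 ^ N * Real.log 2 := by
          rw [intervalIntegral.integral_const_mul]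
          exact mul_le_mul_of_nonneg_left (integral_inv_le_log_two hu) hD
      _ = C * Real.log 2 ^ (N + 1) := by ring

lemma mukIntegral_nonneg (k : ℕ) (u v : ℝ) : 0 ≤ mukIntegral k u v := by
  refine integral_nonneg fun t => indicator_nonneg ?_ t
  intro t ht
  refine Finset.prod_nonneg fun j hj => inv_nonneg.2 ?_
  linarith [one_lt_sub_sum_of_mem_Vk ht (Finset.mem_filter.1 hj).2]

lemma hasSum_mukIntegral {u v : ℝ} (hv : 0 ≤ v) (hv1 : v < 1) (hu : 1 < u) (huv : u ≤ 2 + v) :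
    HasSum (fun k => mukIntegral (k + 1) u v) (u * muSum v u) := by
  rw [hasSum_iff_tendsto_nat_of_nonneg fun k => mukIntegral_nonneg _ u v]
  obtain ⟨C, hC⟩ := isCompact_Icc.exists_bound_of_continuousOn (s := Icc (1:ℝ) (2 + v))
    (f := fun u => u * muSum v u) (continuous_id.mul (continuous_muSum hv)).continuousOn
  have hlog : Real.log 2 < 1 := by linarith [Real.log_two_lt_d9]
  have hpow : Filter.Tendsto (fun N : ℕ => C * Real.log 2 ^ N) Filter.atTop (nhds 0) := by
    simpa using (tendsto_pow_atTop_nhds_zero_of_lt_one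
      (Real.log_nonneg one_le_two) hlog).const_mul C
  have hrem : Filter.Tendsto (fun N => muRemainder v N u) Filter.atTop (nhds 0) :=
    squeeze_zero_norm (fun N => abs_muRemainder_le hv hv1
      (fun w hw hwv => hC w ⟨hw.le, hwv⟩) N u hu huv) hpow
  simpa [muRemainder] using (tendsto_const_nhds (x := u * muSum v u)).sub hrem

lemma mukappa_one_eq_muSum {u v : ℝ} (hv : 0 ≤ v) (hv1 : v < 1) (hu : 1 < u)
    (huv : u ≤ 2 + v) : mukappa 1 u v = muSum v u := by
  have h := ((hasSum_mukIntegral hv hv1 hu huv).mul_left u⁻¹).tsum_eq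
  rw [inv_mul_cancel_left₀ (by linarith)] at h
  simp only [mukappa, one_pow, one_mul, muk_eq_inv_mul_mukIntegral _ v hu, h]

/-- Explicit value of `ρ_{θ,1}` for `1/2 < θ ≤ 2/3` (Corollaire 3.5, (3.11)). -/
theorem rhotheta_value_theta_le_two_thirds (θ : ℝ) (hθ0 : 1/2 < θ) (hθ : θ ≤ 2/3) :
    ∀ u : ℝ,
      (1 < u → u ≤ 1/θ → rhotheta θ 1 u = 1 - (1 - θ) * u) ∧
      (1/θ < u → u ≤ 2 →
        rhotheta θ 1 u = 1 - (1 - θ) * u + Real.log (1/u + 1 - θ)) ∧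
      (2 < u → u < 1 / (1 - θ) →
        rhotheta θ 1 u
          = 1 - (1 - θ) * u + Real.log (1/u + 1 - θ) + (1 - θ) * u * Real.log (u/2)) := by
  intro u
  have hθ1 : 0 < 1 - θ := by linarith
  have key : 1 < u → (1 - θ) * u < 1 → rhotheta θ 1 u = muSum ((1 - θ) * u) u := by
    intro hu hv
    have hu3 : u < 3 := by nlinarith
    exact mukappa_one_eq_muSum (by positivity) hv hu (by nlinarith)
  have hlog : 1 < u → Real.log (1/u + 1 - θ) = -Real.log (u / (1 + (1 - θ) * u)) := by
    intro hu
    rw [← Real.log_inv, inv_div]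
    congr 1
    field_simp
    ring
  refine ⟨fun hu h => ?_, fun h h2 => ?_, fun h2 h => ?_⟩
  · rw [le_div_iff₀ (by linarith)] at h
    have hpos : 0 < 1 + (1 - θ) * u := by positivity
    rw [key hu (by nlinarith), muSum, max_eq_right (by linarith : u ≤ 1 + (1 - θ) * u),
      max_eq_right (by nlinarith : u ≤ 2), div_self hpos.ne', div_self two_ne_zero, Real.log_one]
    ring
  · rw [div_lt_iff₀ (by linarith)] at h
    have hu : 1 < u := by nlinarith
    rw [key hu (by nlinarith), hlog hu, muSum, max_eq_left (by linarith : 1 + (1 - θ) * u ≤ u),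
      max_eq_right h2, div_self two_ne_zero, Real.log_one]
    ring
  · rw [lt_div_iff₀ hθ1] at h
    have hu : 1 < u := by linarith
    rw [key hu (by linarith), hlog hu, muSum, max_eq_left (by linarith : 1 + (1 - θ) * u ≤ u),
      max_eq_left h2.le]
    ring
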